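/- arXiv:1503.05620 — 2 statements merged into one kernel-verified Lean document; each statement's English description precedes it below -/
import Mathlib

section
/- Let R be a nonzero commutative ring and let G be a finite simple graph, viewed as a 1-dimensional simplicial complex. Then G is decomposition 1-chordal over R if and only if G is chordal in the classical sense, i.e., every simple cycle in G of length ≥ 4 has a chord (an edge of G joining two non-adjacent vertices of the cycle). -/
/-!
Basic notions for homological chordality of simplicial complexes,
following Adiprasito–Nevo–Samper, "Higher chordality: From graphs to complexes".

A finite abstract simplicial complex is modelled as a downward-closed finite
family of finite subsets of a vertex type `V`.  Chains of dimension `k` (with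
coefficients in a commutative ring `R`) are functions `Finset V → R` supported
on faces of cardinality `k + 1`; the simplicial boundary operator includes the
augmentation (so `0`-cycles are *reduced* cycles), matching the paper's
convention that `C₋₁` is generated by the empty face.
-/

open Finset

attribute [local instance] Classical.propDecidable

noncomputable section

/-- A finite abstract simplicial complex with vertices in `V`:
a downward-closed finite family of finite subsets of `V`. -/
structure ASC (V : Type*) where
  faces : Finset (Finset V)
  down_closed : ∀ ⦃s t : Finset V⦄, s ∈ faces → t ⊆ s → t ∈ faces

variable {V : Type*} [Fintype V] [LinearOrder V]

/-- `(-1)` to the number of elements of `t` smaller than `v`; this is the sign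
of the position of `v` in the ordered set `insert v t`. -/
def esign (v : V) (t : Finset V) : ℤ :=
  (-1) ^ (t.filter fun w => w < v).card

/-- The simplicial boundary operator (including the augmentation at the empty
face): `(bdry c) t = ∑_{v ∉ t} ± c (insert v t)`. -/
def bdry {R : Type*} [CommRing R] (c : Finset V → R) : Finset V → R :=
  fun t => ∑ v ∈ tᶜ, esign v t • c (insert v t)

/-- `c` is a chain of dimension `k` on the set of faces `S`:
it is supported on members of `S` of cardinality `k + 1`. -/
def IsChainOn {R : Type*} [CommRing R] (S : Set (Finset V)) (k : ℤ)
    (c : Finset V → R) : Prop :=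
  ∀ s : Finset V, c s ≠ 0 → s ∈ S ∧ (s.card : ℤ) = k + 1

/-- The vertex support `c⁰` of a chain: all vertices lying in a face with a
nonzero coefficient. -/
def vsupp {R : Type*} [CommRing R] (c : Finset V → R) : Set V :=
  {v | ∃ s : Finset V, c s ≠ 0 ∧ v ∈ s}

/-- Vanishing of the `k`-th (reduced) homology of the family of faces `S` over `R`:
every `k`-cycle is the boundary of a `(k+1)`-chain. -/
def HVanish (R : Type*) [CommRing R] (S : Set (Finset V)) (k : ℤ) : Prop :=
  ∀ z : Finset V → R, IsChainOn S k z → bdry z = 0 →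
    ∃ c : Finset V → R, IsChainOn S (k + 1) c ∧ bdry c = z

/-- `Δ` is resolution `k`-chordal over `R`: every `k`-cycle `z` of `Δ` admits a
resolution, i.e. a `(k+1)`-chain `c` of `Δ` with `∂c = z` and the same vertex
support as `z`. -/
def ResChordal (R : Type*) [CommRing R] (Δ : ASC V) (k : ℤ) : Prop :=
  ∀ z : Finset V → R, IsChainOn (↑Δ.faces) k z → bdry z = 0 →
    ∃ c : Finset V → R, IsChainOn (↑Δ.faces) (k + 1) c ∧ bdry c = z ∧ vsupp c = vsupp z

/-- `z` is a complete `k`-cycle on the face set `S`: it is a `k`-cycle whose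
faces with nonzero coefficient are precisely all the `k`-dimensional faces of
some set `W` of `k + 2` vertices, and all those faces belong to `S`. -/
def IsCompleteCycleOn {R : Type*} [CommRing R] (S : Set (Finset V)) (k : ℤ)
    (z : Finset V → R) : Prop :=
  bdry z = 0 ∧ ∃ W : Finset V, (W.card : ℤ) = k + 2 ∧
    (∀ s : Finset V, z s ≠ 0 ↔ s ⊆ W ∧ (s.card : ℤ) = k + 1) ∧
    ∀ s : Finset V, s ⊆ W → (s.card : ℤ) = k + 1 → s ∈ S

/-- `Δ` is decomposition `k`-chordal over `R`: every `k`-cycle `z` of `Δ` is a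
sum of complete `k`-cycles of `Δ` supporting only vertices supported in `z`. -/
def DecChordal (R : Type*) [CommRing R] (Δ : ASC V) (k : ℤ) : Prop :=
  ∀ z : Finset V → R, IsChainOn (↑Δ.faces) k z → bdry z = 0 →
    ∃ (n : ℕ) (zs : Fin n → Finset V → R),
      z = ∑ i, zs i ∧
      ∀ i, IsCompleteCycleOn (↑Δ.faces) k (zs i) ∧ vsupp (zs i) ⊆ vsupp z

/-- `σ` is a missing face (minimal nonface) of `Δ`: `σ` is not a face but all
its proper subsets are.  Its dimension is `σ.card - 1`. -/
def IsMissingFace (Δ : ASC V) (σ : Finset V) : Prop :=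
  σ ∉ Δ.faces ∧ ∀ t ⊂ σ, t ∈ Δ.faces

/-- The induced subcomplex `Δ|W` on a subset `W` of the vertices. -/
def induced (Δ : ASC V) (W : Finset V) : ASC V where
  faces := Δ.faces.filter fun s => s ⊆ W
  down_closed := by
    intro s t hs hts
    simp only [mem_filter] at hs ⊢
    exact ⟨Δ.down_closed hs.1 hts, hts.trans hs.2⟩

/-- `Δ` is `k`-Leray over `R`: the reduced homology `H̃ⱼ(Δ|W; R)` vanishes for
every `j ≥ k` and every vertex subset `W`. -/
def IsLeray (R : Type*) [CommRing R] (Δ : ASC V) (k : ℤ) : Prop :=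
  ∀ (W : Finset V) (j : ℤ), k ≤ j → HVanish R (((induced Δ W).faces : Set (Finset V))) j

/-- The closed star `St_σ Δ = ∪_{σ ⊆ τ ∈ Δ} 2^τ`. -/
def star (Δ : ASC V) (σ : Finset V) : ASC V where
  faces := Δ.faces.filter fun s => ∃ τ ∈ Δ.faces, σ ⊆ τ ∧ s ⊆ τ
  down_closed := by
    intro s t hs hts
    simp only [mem_filter] at hs ⊢
    obtain ⟨h1, τ', h2, h3, h4⟩ := hs
    exact ⟨Δ.down_closed h1 hts, τ', h2, h3, hts.trans h4⟩

/-- The deletion `Δ - σ`: the maximal subcomplex of `Δ` not containing `σ`. -/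
def del (Δ : ASC V) (σ : Finset V) : ASC V where
  faces := Δ.faces.filter fun s => ¬ σ ⊆ s
  down_closed := by
    intro s t hs hts
    simp only [mem_filter] at hs ⊢
    exact ⟨Δ.down_closed hs.1 hts, fun h => hs.2 (h.trans hts)⟩

/-- The extended link `eLk_σ Δ = St_σ Δ - σ`. -/
def eLk (Δ : ASC V) (σ : Finset V) : ASC V := del (star Δ σ) σ

/-- The link `Lk_σ Δ = {τ \ σ : σ ⊆ τ ∈ Δ}`. -/
def link (Δ : ASC V) (σ : Finset V) : ASC V where
  faces := Finset.univ.filter fun t => Disjoint σ t ∧ σ ∪ t ∈ Δ.faces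
  down_closed := by
    intro s t hs hts
    simp only [mem_filter, mem_univ, true_and] at hs ⊢
    exact ⟨hs.1.mono_right hts, Δ.down_closed hs.2 (union_subset_union_right hts)⟩

/-- The `k`-clique complex `Cl_k Δ`: faces are the sets of vertices of `Δ` all
of whose subsets of cardinality at most `k + 1` are faces of `Δ`. -/
def clique (Δ : ASC V) (k : ℤ) : ASC V where
  faces := Finset.univ.filter fun s =>
    (∀ v ∈ s, {v} ∈ Δ.faces) ∧ ∀ t ⊆ s, (t.card : ℤ) ≤ k + 1 → t ∈ Δ.faces
  down_closed := by
    intro s t hs hts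
    simp only [mem_filter, mem_univ, true_and] at hs ⊢
    exact ⟨fun v hv => hs.1 v (hts hv), fun u hu hc => hs.2 u (hu.trans hts) hc⟩

/-- The vertex set of a complex, as a set of elements of `V`. -/
def vertexSet (Δ : ASC V) : Set V := {v | {v} ∈ Δ.faces}

/-- The relative simplicial complex `(Δ, Γ)` is resolution `k`-chordal over `R`:
every relative `k`-cycle (a `k`-chain of `Δ` supported off `Γ` whose boundary
is a chain of `Γ`) admits a resolution, i.e. a `(k+1)`-chain `c` of `Δ`
supported off `Γ` with `∂c ≡ z` modulo chains of `Γ` and `vsupp c = vsupp z`. -/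
def RelResChordal (R : Type*) [CommRing R] (Δ Γ : ASC V) (k : ℤ) : Prop :=
  ∀ z : Finset V → R, IsChainOn (↑Δ.faces) k z → (∀ s, z s ≠ 0 → s ∉ Γ.faces) →
    IsChainOn (↑Γ.faces) (k - 1) (bdry z) →
    ∃ c : Finset V → R, IsChainOn (↑Δ.faces) (k + 1) c ∧ (∀ s, c s ≠ 0 → s ∉ Γ.faces) ∧
      IsChainOn (↑Γ.faces) k (bdry c - z) ∧ vsupp c = vsupp z

/-- The union of two simplicial complexes (taken facewise). -/
def aunion (Δ Γ : ASC V) : ASC V where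
  faces := Δ.faces ∪ Γ.faces
  down_closed := by
    intro s t hs hts
    rcases Finset.mem_union.1 hs with h | h
    · exact Finset.mem_union.2 (Or.inl (Δ.down_closed h hts))
    · exact Finset.mem_union.2 (Or.inr (Γ.down_closed h hts))

/-- The intersection of two simplicial complexes (taken facewise). -/
def ainter (Δ Γ : ASC V) : ASC V where
  faces := Δ.faces ∩ Γ.faces
  down_closed := by
    intro s t hs hts
    rw [Finset.mem_inter] at hs ⊢
    exact ⟨Δ.down_closed hs.1 hts, Γ.down_closed hs.2 hts⟩

/-- The `k`-skeleton of `Δ`: all faces of dimension at most `k`. -/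
def skel (Δ : ASC V) (k : ℤ) : ASC V where
  faces := Δ.faces.filter fun s => (s.card : ℤ) ≤ k + 1
  down_closed := by
    intro s t hs hts
    simp only [mem_filter] at hs ⊢
    refine ⟨Δ.down_closed hs.1 hts, le_trans ?_ hs.2⟩
    exact_mod_cast Finset.card_le_card hts

/-- A finite simple graph, viewed as a one-dimensional simplicial complex whose
faces are the empty set, the vertices, and the edges. -/
def graphComplex {V : Type*} [Fintype V] [LinearOrder V] (G : SimpleGraph V) : ASC V where
  faces := Finset.univ.filter fun s => s.card ≤ 2 ∧ ∀ u ∈ s, ∀ v ∈ s, u ≠ v → G.Adj u v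
  down_closed := by
    intro s t hs hts
    simp only [mem_filter, mem_univ, true_and] at hs ⊢
    exact ⟨le_trans (Finset.card_le_card hts) hs.1,
      fun u hu v hv huv => hs.2 u (hts hu) v (hts hv) huv⟩

section Orientation

variable (R : Type*) [CommRing R]

/-- The sign, in `R`, of the ordered pair `(x, y)`: `1` if `x < y`, `-1` if `y < x`,
and `0` if `x = y`. -/
def orientSign (x y : V) : R := if x < y then 1 else if y < x then -1 else 0

omit [Fintype V] in
lemma orientSign_swap (x y : V) : orientSign R y x = -orientSign R x y := by
  rcases lt_trichotomy x y with h | h | h <;> simp [orientSign, h, h.not_gt]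

omit [Fintype V] in
lemma orientSign_mul_self {x y : V} (h : x ≠ y) : orientSign R x y * orientSign R x y = 1 := by
  rcases lt_or_gt_of_ne h with h | h <;> simp [orientSign, h, h.not_gt]

omit [Fintype V] in
lemma esign_singleton_smul {x v : V} (h : v ≠ x) (r : R) :
    esign v {x} • r = orientSign R v x * r := by
  rcases lt_or_gt_of_ne h with h | h <;>
    simp [esign, orientSign, h, h.not_gt, Finset.filter_singleton]

end Orientation

section Chains

variable {R : Type*} [CommRing R]

omit [Fintype V] [LinearOrder V] in
lemma finset_pair_eq_pair_iff {a b c d : V} :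
    ({a, b} : Finset V) = {c, d} ↔ a = c ∧ b = d ∨ a = d ∧ b = c := by
  rw [← Finset.coe_inj]
  simp [Set.pair_eq_pair_iff]

lemma bdry_singleton (c : Finset V → R) (x : V) :
    bdry c {x} = ∑ v, orientSign R v x * c {v, x} := by
  unfold bdry
  rw [← Finset.sum_subset (Finset.subset_univ ({x}ᶜ : Finset V))]
  · refine Finset.sum_congr rfl fun v hv => ?_
    exact esign_singleton_smul R (by simpa using hv) _
  · intro v _ hv
    have : v = x := by simpa using hv
    simp [this, orientSign]

lemma bdry_eq_zero_iff {c : Finset V → R} (hc : ∀ s, c s ≠ 0 → s.card = 2) :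
    bdry c = 0 ↔ ∀ x, bdry c {x} = 0 := by
  refine ⟨fun h x => by rw [h]; rfl, fun h => funext fun t => ?_⟩
  by_cases ht : t.card = 1
  · obtain ⟨x, rfl⟩ := Finset.card_eq_one.1 ht
    exact h x
  · refine Finset.sum_eq_zero fun v hv => ?_
    have hv' : v ∉ t := by simpa using hv
    have : c (insert v t) = 0 := by
      by_contra h0
      have := hc _ h0
      rw [Finset.card_insert_of_notMem hv'] at this
      omega
    rw [this, smul_zero]

lemma bdry_add (c d : Finset V → R) : bdry (c + d) = bdry c + bdry d := by
  funext t
  simp [bdry, Finset.sum_add_distrib]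

lemma bdry_smul (a : R) (c : Finset V → R) : bdry (a • c) = a • bdry c := by
  funext t
  simp only [bdry, Pi.smul_apply, Finset.smul_sum]
  exact Finset.sum_congr rfl fun v _ => smul_comm _ _ _

variable (R) in
/-- The oriented edge from `u` to `v`, as a `1`-chain. -/
def edgeChain (u v : V) : Finset V → R := fun s => if s = {u, v} then orientSign R u v else 0

omit [Fintype V] in
lemma edgeChain_swap (u v : V) : edgeChain R v u = -edgeChain R u v := by
  funext s
  simp only [edgeChain, Pi.neg_apply, Finset.pair_comm v u, orientSign_swap R u v]
  split_ifs <;> simp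

lemma bdry_edgeChain {u v : V} (h : u ≠ v) (x : V) :
    bdry (edgeChain R u v) {x} = (if x = v then 1 else 0) - (if x = u then 1 else 0) := by
  rw [bdry_singleton]
  by_cases hv : x = v
  · subst hv
    rw [Finset.sum_eq_single u]
    · simp [edgeChain, orientSign_mul_self R h, h.symm]
    · intro b _ hb
      simp only [edgeChain, finset_pair_eq_pair_iff]
      rw [if_neg (by tauto), mul_zero]
    · simp
  · by_cases hu : x = u
    · subst hu
      rw [Finset.sum_eq_single v]
      · simp [edgeChain, Finset.pair_comm v x, orientSign_swap R x v, orientSign_mul_self R h, h]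
      · intro b _ hb
        simp only [edgeChain, finset_pair_eq_pair_iff]
        rw [if_neg (by tauto), mul_zero]
      · simp
    · rw [Finset.sum_eq_zero, if_neg hv, if_neg hu, sub_zero]
      intro b _
      simp only [edgeChain, finset_pair_eq_pair_iff]
      rw [if_neg (by tauto), mul_zero]

variable {G : SimpleGraph V}

variable (R) in
/-- The `1`-chain traversed by a walk: the sum of its oriented edges. -/
def walkChain {u v : V} : G.Walk u v → Finset V → R
  | .nil => 0
  | .cons (u := a) (v := b) _ p => edgeChain R a b + walkChain p

omit [Fintype V] in
@[simp] lemma walkChain_nil {u : V} : walkChain R (.nil : G.Walk u u) = 0 := rfl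

omit [Fintype V] in
@[simp] lemma walkChain_cons {u v w : V} (h : G.Adj u v) (p : G.Walk v w) :
    walkChain R (.cons h p) = edgeChain R u v + walkChain R p := rfl

omit [Fintype V] in
lemma walkChain_append {u v w : V} (p : G.Walk u v) (q : G.Walk v w) :
    walkChain R (p.append q) = walkChain R p + walkChain R q := by
  induction p with
  | nil => simp
  | cons h p ih => simp [ih, add_assoc]

omit [Fintype V] in
lemma walkChain_rotate {u v : V} (p : G.Walk v v) (hu : u ∈ p.support) :
    walkChain R (p.rotate u hu) = walkChain R p := by
  rw [SimpleGraph.Walk.rotate, walkChain_append, add_comm, ← walkChain_append,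
    SimpleGraph.Walk.take_spec]

omit [Fintype V] in
lemma walkChain_mapLe {H : SimpleGraph V} (hHG : H ≤ G) {u v : V} (p : H.Walk u v) :
    walkChain R (p.mapLe hHG) = walkChain R p := by
  induction p with
  | nil => rfl
  | cons h p ih => exact congrArg (_ + ·) ih

omit [Fintype V] in
lemma exists_edge_of_walkChain_ne_zero {u v : V} {p : G.Walk u v} {s : Finset V}
    (hs : walkChain R p s ≠ 0) : ∃ x y, s(x, y) ∈ p.edges ∧ s = {x, y} := by
  induction p with
  | nil => simp at hs
  | @cons a b c h p ih =>
    by_cases hp : walkChain R p s = 0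
    · refine ⟨a, b, by simp, ?_⟩
      by_contra hne
      simp [hp, edgeChain, hne] at hs
    · obtain ⟨x, y, hxy, rfl⟩ := ih hp
      exact ⟨x, y, by simp [hxy], rfl⟩

omit [Fintype V] in
lemma walkChain_eq_zero_of_notMem {u v : V} {p : G.Walk u v} {x y : V}
    (h : s(x, y) ∉ p.edges) : walkChain R p {x, y} = 0 := by
  by_contra h0
  obtain ⟨a, b, hab, he⟩ := exists_edge_of_walkChain_ne_zero h0
  rw [finset_pair_eq_pair_iff] at he
  refine h ?_
  rwa [show s(x, y) = s(a, b) from Sym2.eq_iff.2 he]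

omit [Fintype V] in
lemma walkChain_mul_self {u v : V} {p : G.Walk u v} (hp : p.IsTrail) {x y : V}
    (h : s(x, y) ∈ p.edges) : walkChain R p {x, y} * walkChain R p {x, y} = 1 := by
  induction p with
  | nil => simp at h
  | @cons a b c hab p ih =>
    rw [SimpleGraph.Walk.isTrail_cons] at hp
    by_cases hxy : s(x, y) = s(a, b)
    · have hs : ({x, y} : Finset V) = {a, b} := finset_pair_eq_pair_iff.2 (Sym2.eq_iff.1 hxy)
      rw [hs, walkChain_cons, Pi.add_apply, walkChain_eq_zero_of_notMem hp.2]
      simp [edgeChain, orientSign_mul_self R hab.ne]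
    · have hmem : s(x, y) ∈ p.edges := by simpa [hxy] using h
      have hs : ({x, y} : Finset V) ≠ {a, b} := fun he =>
        hxy (Sym2.eq_iff.2 (finset_pair_eq_pair_iff.1 he))
      simpa [edgeChain, hs] using ih hp.1 hmem

omit [Fintype V] in
lemma card_eq_two_of_walkChain_ne_zero {u v : V} {p : G.Walk u v} {s : Finset V}
    (hs : walkChain R p s ≠ 0) : s.card = 2 := by
  obtain ⟨x, y, hxy, rfl⟩ := exists_edge_of_walkChain_ne_zero hs
  exact Finset.card_pair (p.adj_of_mem_edges hxy).ne

lemma bdry_walkChain_singleton {u v : V} (p : G.Walk u v) (x : V) :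
    bdry (walkChain R p) {x} = (if x = v then 1 else 0) - (if x = u then 1 else 0) := by
  induction p with
  | nil => simp [bdry]
  | cons h p ih =>
    rw [walkChain_cons, bdry_add, Pi.add_apply, ih, bdry_edgeChain h.ne]
    ring

lemma bdry_walkChain_eq_zero {u : V} (p : G.Walk u u) : bdry (walkChain R p) = 0 :=
  (bdry_eq_zero_iff fun _ => card_eq_two_of_walkChain_ne_zero).2 fun x => by
    rw [bdry_walkChain_singleton, sub_self]

lemma pair_mem_faces_graphComplex {x y : V} (h : G.Adj x y) :
    ({x, y} : Finset V) ∈ (graphComplex G).faces := by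
  simp only [graphComplex, mem_filter, mem_univ, true_and]
  refine ⟨Finset.card_le_two, ?_⟩
  simp only [mem_insert, mem_singleton]
  rintro u (rfl | rfl) v (rfl | rfl) huv
  · exact absurd rfl huv
  · exact h
  · exact h.symm
  · exact absurd rfl huv

lemma adj_of_pair_mem_faces_graphComplex {x y : V} (hne : x ≠ y)
    (h : ({x, y} : Finset V) ∈ (graphComplex G).faces) : G.Adj x y := by
  simp only [graphComplex, mem_filter, mem_univ, true_and] at h
  exact h.2 x (by simp) y (by simp) hne

lemma isChainOn_walkChain {u v : V} (p : G.Walk u v) :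
    IsChainOn ↑(graphComplex G).faces 1 (walkChain R p) := by
  intro s hs
  refine ⟨?_, by rw [card_eq_two_of_walkChain_ne_zero hs]; rfl⟩
  obtain ⟨x, y, hxy, rfl⟩ := exists_edge_of_walkChain_ne_zero hs
  exact pair_mem_faces_graphComplex (p.adj_of_mem_edges hxy)

omit [Fintype V] in
lemma vsupp_smul_walkChain_subset {u v : V} (a : R) (p : G.Walk u v) :
    vsupp (a • walkChain R p) ⊆ {x | x ∈ p.support} := by
  rintro x ⟨s, hs, hx⟩
  obtain ⟨y, z, hyz, rfl⟩ := exists_edge_of_walkChain_ne_zero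
    (right_ne_zero_of_mul (show a * walkChain R p s ≠ 0 from hs))
  rcases Finset.mem_insert.1 hx with rfl | hx
  · exact p.fst_mem_support_of_mem_edges hyz
  · rw [Finset.mem_singleton.1 hx]
    exact p.snd_mem_support_of_mem_edges hyz

end Chains

section Decomposition

variable (R : Type*) [CommRing R] (G : SimpleGraph V)

/-- The complete `1`-cycles of a graph all of whose vertices lie in `W`. -/
def completeCyclesWithin (W : Set V) : Set (Finset V → R) :=
  {c | IsCompleteCycleOn ↑(graphComplex G).faces 1 c ∧ vsupp c ⊆ W}

variable {R G}

lemma closure_completeCyclesWithin_mono {W W' : Set V} (h : W ⊆ W') :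
    AddSubmonoid.closure (completeCyclesWithin R G W) ≤
      AddSubmonoid.closure (completeCyclesWithin R G W') :=
  AddSubmonoid.closure_mono fun _ hc => ⟨hc.1, hc.2.trans h⟩

lemma exists_fin_sum_of_mem_closure {M : Type*} [AddCommMonoid M] {T : Set M} {z : M}
    (h : z ∈ AddSubmonoid.closure T) :
    ∃ (n : ℕ) (zs : Fin n → M), z = ∑ i, zs i ∧ ∀ i, zs i ∈ T := by
  obtain ⟨l, hl, rfl⟩ := AddSubmonoid.exists_list_of_mem_closure h
  exact ⟨l.length, l.get, by simp, fun i => hl _ (l.get_mem i)⟩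

lemma isCompleteCycleOn_smul_walkChain {v : V} {w : G.Walk v v} (hw : w.IsCycle)
    (hlen : w.length = 3) {a : R} (ha : a ≠ 0) :
    IsCompleteCycleOn ↑(graphComplex G).faces 1 (a • walkChain R w) := by
  refine ⟨by rw [bdry_smul, bdry_walkChain_eq_zero, smul_zero], ?_⟩
  have hne : ∀ x y, s(x, y) ∈ w.edges → (a • walkChain R w) {x, y} ≠ 0 := by
    intro x y hxy h0
    have h1 := walkChain_mul_self (R := R) hw.isTrail hxy
    apply ha
    calc a = a * (walkChain R w {x, y} * walkChain R w {x, y}) := by rw [h1, mul_one]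
      _ = (a • walkChain R w) {x, y} * walkChain R w {x, y} := by
        rw [Pi.smul_apply, smul_eq_mul, mul_assoc]
      _ = 0 := by rw [h0, zero_mul]
  obtain ⟨b, c, hab, hbc, hca, rfl⟩ : ∃ (b c : V) (hab : G.Adj v b) (hbc : G.Adj b c)
      (hca : G.Adj c v), w = .cons hab (.cons hbc (.cons hca .nil)) := by
    match w, hlen with
    | .cons h₁ (.cons h₂ (.cons h₃ .nil)), _ => exact ⟨_, _, h₁, h₂, h₃, rfl⟩
  have hsub : ∀ s : Finset V, s ⊆ {v, b, c} → (s.card : ℤ) = 1 + 1 →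
      ∃ x y, s(x, y) ∈ (SimpleGraph.Walk.cons hab (.cons hbc (.cons hca .nil))).edges ∧
        s = {x, y} := by
    intro s hs hcard
    obtain ⟨x, y, hxy, rfl⟩ := Finset.card_eq_two.1 (by omega : s.card = 2)
    refine ⟨x, y, ?_, rfl⟩
    have hx : x ∈ ({v, b, c} : Finset V) := hs (by simp)
    have hy : y ∈ ({v, b, c} : Finset V) := hs (by simp)
    simp only [mem_insert, mem_singleton] at hx hy
    rcases hx with rfl | rfl | rfl <;> rcases hy with rfl | rfl | rfl <;> simp_all
  refine ⟨{v, b, c}, ?_, fun s => ⟨fun hs => ?_, fun hs => ?_⟩, fun s hs hcard => ?_⟩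
  · rw [Finset.card_eq_three.2 ⟨v, b, c, hab.ne, hca.ne', hbc.ne, rfl⟩]
    rfl
  · have hs' := right_ne_zero_of_mul (show a * walkChain R _ s ≠ 0 from hs)
    refine ⟨?_, by rw [card_eq_two_of_walkChain_ne_zero hs']; rfl⟩
    intro x hx
    have := vsupp_smul_walkChain_subset a _ ⟨s, hs, hx⟩
    simp at this ⊢
    tauto
  · obtain ⟨x, y, hxy, rfl⟩ := hsub s hs.1 hs.2
    exact hne x y hxy
  · obtain ⟨x, y, hxy, rfl⟩ := hsub s hs hcard
    exact pair_mem_faces_graphComplex (SimpleGraph.Walk.adj_of_mem_edges _ hxy)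

omit [Fintype V] in
/-- A chord of a cycle splits it into two strictly shorter cycles on the same vertices. -/
lemma exists_split_of_chord {v : V} {w : G.Walk v v} (hw : w.IsCycle) {x y : V}
    (hx : x ∈ w.support) (hy : y ∈ w.support) (hxy : G.Adj x y) (hch : s(x, y) ∉ w.edges) :
    ∃ (c : G.Walk y y) (d : G.Walk x x), c.IsCycle ∧ d.IsCycle ∧
      c.length < w.length ∧ d.length < w.length ∧
      {z | z ∈ c.support} ⊆ {z | z ∈ w.support} ∧ {z | z ∈ d.support} ⊆ {z | z ∈ w.support} ∧
      walkChain R w = walkChain R c + walkChain R d := by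
  rw [← walkChain_rotate w hx, ← w.length_rotate x hx]
  simp only [← w.mem_support_rotate_iff x hx] at hy ⊢
  have hcyc := hw.rotate hx
  have hedge : s(x, y) ∉ (w.rotate x hx).edges := (w.rotate_edges x hx).mem_iff.not.2 hch
  generalize w.rotate x hx = w' at *
  obtain ⟨p, q, rfl⟩ := SimpleGraph.Walk.mem_support_iff_exists_append.1 hy
  have hp : p.IsPath := hcyc.isPath_of_append_left (SimpleGraph.Walk.not_nil_of_ne hxy.ne')
  have hq : q.IsPath := hcyc.isPath_of_append_right (SimpleGraph.Walk.not_nil_of_ne hxy.ne)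
  simp only [SimpleGraph.Walk.edges_append, List.mem_append, not_or] at hedge
  have two_le : ∀ {a b : V} (r : G.Walk a b), a ≠ b → s(a, b) ∉ r.edges → 2 ≤ r.length := by
    intro a b r hab hr
    match r with
    | .nil => exact absurd rfl hab
    | .cons h .nil => simp at hr
    | .cons _ (.cons _ r) => simp
  have hpl := two_le p hxy.ne hedge.1
  have hql := two_le q hxy.ne' (by rw [Sym2.eq_swap]; exact hedge.2)
  refine ⟨.cons hxy.symm p, .cons hxy q, ?_, ?_, ?_, ?_, ?_, ?_, ?_⟩
  · rw [SimpleGraph.Walk.cons_isCycle_iff, Sym2.eq_swap]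
    exact ⟨hp, hedge.1⟩
  · rw [SimpleGraph.Walk.cons_isCycle_iff]
    exact ⟨hq, hedge.2⟩
  · simp only [SimpleGraph.Walk.length_cons, SimpleGraph.Walk.length_append]
    omega
  · simp only [SimpleGraph.Walk.length_cons, SimpleGraph.Walk.length_append]
    omega
  · intro z hz
    have : z = y ∨ z ∈ p.support := by simpa using hz
    rcases this with rfl | h
    · exact hy
    · exact (SimpleGraph.Walk.mem_support_append_iff _ _).2 (Or.inl h)
  · intro z hz
    have : z = x ∨ z ∈ q.support := by simpa using hz
    rcases this with rfl | h
    · exact SimpleGraph.Walk.start_mem_support _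
    · exact (SimpleGraph.Walk.mem_support_append_iff _ _).2 (Or.inr h)
  · rw [walkChain_append, walkChain_cons, walkChain_cons, edgeChain_swap]
    abel

lemma smul_walkChain_mem_closure
    (hG : ∀ (v : V) (w : G.Walk v v), w.IsCycle → 4 ≤ w.length →
        ∃ x y : V, x ∈ w.support ∧ y ∈ w.support ∧ G.Adj x y ∧ s(x, y) ∉ w.edges)
    (a : R) {v : V} (w : G.Walk v v) (hw : w.IsCycle) :
    a • walkChain R w ∈
      AddSubmonoid.closure (completeCyclesWithin R G {x | x ∈ w.support}) := by
  induction hn : w.length using Nat.strong_induction_on generalizing v w with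
  | _ n ih =>
    subst hn
    by_cases ha : a = 0
    · rw [ha, zero_smul]
      exact zero_mem _
    rcases hw.three_le_length.eq_or_lt with h3 | h4
    · exact AddSubmonoid.subset_closure
        ⟨isCompleteCycleOn_smul_walkChain hw h3.symm ha, vsupp_smul_walkChain_subset a w⟩
    · obtain ⟨x, y, hx, hy, hxy, hch⟩ := hG v w hw h4
      obtain ⟨c, d, hc, hd, hcl, hdl, hcs, hds, he⟩ :=
        exists_split_of_chord (R := R) hw hx hy hxy hch
      rw [he, smul_add]
      exact add_mem (closure_completeCyclesWithin_mono hcs (ih _ hcl c hc rfl))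
        (closure_completeCyclesWithin_mono hds (ih _ hdl d hd rfl))

/-- The graph whose edges carry a nonzero coefficient in `z`. -/
def supportGraph (z : Finset V → R) : SimpleGraph V where
  Adj x y := x ≠ y ∧ z {x, y} ≠ 0
  symm := ⟨fun x y h => ⟨h.1.symm, by rw [Finset.pair_comm]; exact h.2⟩⟩
  loopless := ⟨fun _ h => h.1 rfl⟩

/-- In the support graph of a `1`-cycle no vertex is a leaf. -/
lemma exists_adj_ne_of_bdry_eq_zero {z : Finset V → R} (hz : bdry z = 0) {u v : V}
    (h : (supportGraph z).Adj u v) : ∃ t, t ≠ v ∧ (supportGraph z).Adj u t := by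
  by_contra! hcon
  have hb : bdry z {u} = 0 := by rw [hz]; rfl
  rw [bdry_singleton, Finset.sum_eq_single v] at hb
  · apply h.2
    rw [Finset.pair_comm]
    calc z {v, u} = orientSign R v u * (orientSign R v u * z {v, u}) := by
          rw [← mul_assoc, orientSign_mul_self R h.1.symm, one_mul]
      _ = 0 := by rw [hb, mul_zero]
  · intro t _ ht
    by_cases htu : t = u
    · simp [htu, orientSign]
    · have h0 : z {t, u} = 0 := by
        by_contra h0
        exact hcon t ht ⟨Ne.symm htu, by rwa [Finset.pair_comm]⟩
      rw [h0, mul_zero]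
  · simp

omit [LinearOrder V] in
lemma not_isAcyclic_of_exists_adj_ne {H : SimpleGraph V} {a b : V} (hab : H.Adj a b)
    (hH : ∀ u v, H.Adj u v → ∃ t, t ≠ v ∧ H.Adj u t) : ¬ H.IsAcyclic := by
  intro hac
  have key : ∀ n : ℕ, ∃ (u v : V) (p : H.Walk u v), p.IsPath ∧ p.length = n + 1 := by
    intro n
    induction n with
    | zero => exact ⟨a, b, .cons hab .nil, by simp [hab.ne], rfl⟩
    | succ n ih =>
      obtain ⟨u, v, p, hp, hl⟩ := ih
      have hnil : ¬ p.Nil := by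
        rw [← SimpleGraph.Walk.length_eq_zero_iff]
        omega
      obtain ⟨t, ht, hut⟩ := hH u p.snd (p.adj_snd hnil)
      refine ⟨t, v, .cons hut.symm p, ?_, by simp [hl]⟩
      rw [SimpleGraph.Walk.cons_isPath_iff]
      exact ⟨hp, fun hmem => ht (hac.eq_snd_of_adj_start hp hut hmem)⟩
  obtain ⟨u, v, p, hp, hl⟩ := key (Fintype.card V)
  have := hp.length_lt
  omega

lemma mem_closure_of_isChordal
    (hG : ∀ (v : V) (w : G.Walk v v), w.IsCycle → 4 ≤ w.length →
        ∃ x y : V, x ∈ w.support ∧ y ∈ w.support ∧ G.Adj x y ∧ s(x, y) ∉ w.edges)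
    (z : Finset V → R) (hz : IsChainOn ↑(graphComplex G).faces 1 z) (hb : bdry z = 0) :
    z ∈ AddSubmonoid.closure (completeCyclesWithin R G (vsupp z)) := by
  induction hn : (univ.filter fun s => z s ≠ 0).card using Nat.strong_induction_on
    generalizing z with
  | _ n ih =>
    subst hn
    by_cases hz0 : z = 0
    · rw [hz0]
      exact zero_mem _
    obtain ⟨s, hs⟩ := Function.ne_iff.1 hz0
    have hs' : z s ≠ 0 := hs
    obtain ⟨x, y, hxy, rfl⟩ := Finset.card_eq_two.1 (by have := (hz s hs').2; omega : s.card = 2)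
    have hadj : (supportGraph z).Adj x y := ⟨hxy, hs'⟩
    have hnac := not_isAcyclic_of_exists_adj_ne hadj
      fun u v h => exists_adj_ne_of_bdry_eq_zero hb h
    simp only [SimpleGraph.IsAcyclic, not_forall, not_not] at hnac
    obtain ⟨v, w, hw⟩ := hnac
    have hle : supportGraph z ≤ G := fun a b hab =>
      adj_of_pair_mem_faces_graphComplex hab.1 (hz _ hab.2).1
    have hsupp : {t | t ∈ w.support} ⊆ vsupp z := by
      intro t ht
      obtain ⟨e, he, hte⟩ := (SimpleGraph.Walk.mem_support_iff_exists_mem_edges_of_not_nil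
        hw.not_nil).1 ht
      induction e with
      | _ a b =>
        exact ⟨{a, b}, (w.adj_of_mem_edges he).2, by simpa using hte⟩
    have hzero : ∀ s, z s = 0 → walkChain R w s = 0 := by
      intro s hs
      by_contra h0
      obtain ⟨a, b, hab, rfl⟩ := exists_edge_of_walkChain_ne_zero h0
      exact (w.adj_of_mem_edges hab).2 hs
    obtain ⟨a, b, hedge⟩ : ∃ a b, s(a, b) ∈ w.edges := by
      match w, hw with
      | .nil, hw => exact absurd rfl hw.ne_nil
      | .cons _ _, _ => exact ⟨_, _, List.mem_cons_self⟩
    have hε := walkChain_mul_self (R := R) hw.isTrail hedge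
    set r : R := z {a, b} * walkChain R w {a, b} with hr
    set z' : Finset V → R := z + (-r) • walkChain R w with hz'
    have hz'0 : ∀ s, z s = 0 → z' s = 0 := by
      intro s hs
      simp [hz', hs, hzero s hs]
    have hz'ab : z' {a, b} = 0 := by
      simp only [hz', hr, Pi.add_apply, Pi.smul_apply, smul_eq_mul]
      linear_combination (-z {a, b}) * hε
    have hmem := ih _ (Finset.card_lt_card (Finset.ssubset_iff_of_subset (by
        intro s
        simp only [mem_filter, mem_univ, true_and]
        exact mt (hz'0 s)) |>.2 ⟨{a, b}, by
          simpa using (w.adj_of_mem_edges hedge).2, by simpa using hz'ab⟩)) z'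
      (fun s hs => hz s (mt (hz'0 s) hs))
      (by rw [hz', bdry_add, hb, bdry_smul, bdry_walkChain_eq_zero, smul_zero, add_zero]) rfl
    have hcyc := smul_walkChain_mem_closure hG r (w.mapLe hle) (hw.mapLe hle)
    rw [walkChain_mapLe, SimpleGraph.Walk.support_mapLe_eq_support] at hcyc
    have hsum : z = z' + r • walkChain R w := by
      rw [hz', neg_smul, neg_add_cancel_right]
    have hvs : vsupp z' ⊆ vsupp z := fun t ⟨s, hs, ht⟩ => ⟨s, mt (hz'0 s) hs, ht⟩
    have := add_mem (closure_completeCyclesWithin_mono hvs hmem)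
      (closure_completeCyclesWithin_mono hsupp hcyc)
    rwa [← hsum] at this

end Decomposition

section Triangles

variable {G : SimpleGraph V}

omit [Fintype V] [LinearOrder V] in
lemma support_subset_of_edges_closed {S : Set V} {u v : V} (p : G.Walk u v) (hu : u ∈ S)
    (hS : ∀ x y, x ∈ S → s(x, y) ∈ p.edges → y ∈ S) : ∀ x ∈ p.support, x ∈ S := by
  induction p with
  | nil => simpa using hu
  | @cons a b c h p ih =>
    have hb : b ∈ S := hS a b hu (by simp)
    simp only [SimpleGraph.Walk.support_cons, List.mem_cons, forall_eq_or_imp]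
    exact ⟨hu, ih hb fun x y hx hxy => hS x y hx (by simp [hxy])⟩

omit [LinearOrder V] in
/-- A vertex of a cycle lies on no more than two edges of the cycle. -/
lemma eq_or_eq_of_mem_edges_of_isCycle {v : V} {w : G.Walk v v} (hw : w.IsCycle) {x a b t : V}
    (hab : a ≠ b) (ha : s(x, a) ∈ w.edges) (hb : s(x, b) ∈ w.edges) (ht : s(x, t) ∈ w.edges) :
    t = a ∨ t = b := by
  have h2 := hw.ncard_neighborSet_toSubgraph_eq_two (w.fst_mem_support_of_mem_edges ha)
  have hmem : ∀ y, s(x, y) ∈ w.edges → y ∈ w.toSubgraph.neighborSet x := fun y hy => by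
    rwa [SimpleGraph.Subgraph.mem_neighborSet, ← SimpleGraph.Subgraph.mem_edgeSet,
      SimpleGraph.Walk.mem_edges_toSubgraph]
  have hsub : ({a, b} : Set V) ⊆ w.toSubgraph.neighborSet x := by
    rintro y (rfl | rfl)
    exacts [hmem _ ha, hmem _ hb]
  have heq := Set.eq_of_subset_of_ncard_le hsub (by rw [h2, Set.ncard_pair hab])
  have := hmem t ht
  rwa [← heq] at this

omit [LinearOrder V] in
/-- A cycle containing the three edges of a triangle has length at most `3`. -/
lemma length_le_three_of_triangle {v : V} {w : G.Walk v v} (hw : w.IsCycle) {a b c : V}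
    (hab : a ≠ b) (hac : a ≠ c) (hbc : b ≠ c) (eab : s(a, b) ∈ w.edges)
    (eac : s(a, c) ∈ w.edges) (ebc : s(b, c) ∈ w.edges) : w.length ≤ 3 := by
  have ha : a ∈ w.support := w.fst_mem_support_of_mem_edges eab
  have hclosed : ∀ x y, x ∈ ({a, b, c} : Set V) → s(x, y) ∈ w.edges →
      y ∈ ({a, b, c} : Set V) := by
    rintro x y (rfl | rfl | rfl) hxy
    · rcases eq_or_eq_of_mem_edges_of_isCycle hw hbc eab eac hxy with rfl | rfl <;> simp
    · rcases eq_or_eq_of_mem_edges_of_isCycle hw hac (Sym2.eq_swap ▸ eab) ebc hxy with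
        rfl | rfl <;> simp
    · rcases eq_or_eq_of_mem_edges_of_isCycle hw hab (Sym2.eq_swap ▸ eac) (Sym2.eq_swap ▸ ebc)
        hxy with rfl | rfl <;> simp
  have hsub := support_subset_of_edges_closed (w.rotate a ha) (S := {a, b, c}) (by simp)
    fun x y hx hxy => hclosed x y hx ((w.rotate_edges a ha).mem_iff.1 hxy)
  have hnd := hw.support_nodup
  have hle : w.support.tail.toFinset ⊆ {a, b, c} := by
    intro x hx
    have := hsub x ((w.mem_support_rotate_iff a ha).2
      (List.mem_of_mem_tail (List.mem_toFinset.1 hx)))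
    simpa using this
  have h1 := Finset.card_le_card hle
  rw [List.toFinset_card_of_nodup hnd] at h1
  have h2 : w.support.tail.length = w.length := by simp
  have h3 := Finset.card_le_three (a := a) (b := b) (c := c)
  omega

end Triangles

/-- Fact 3.1(1): a finite simple graph is decomposition `1`-chordal over a
nonzero commutative ring `R` if and only if it is chordal in the classical
sense: every simple cycle of length at least `4` has a chord, i.e. an edge of
`G` joining two vertices of the cycle that is not an edge of the cycle. -/
theorem decChordal_one_iff_chordal {V : Type*} [Fintype V] [LinearOrder V]
    (R : Type*) [CommRing R] [Nontrivial R] (G : SimpleGraph V) :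
    DecChordal R (graphComplex G) 1 ↔
      ∀ (v : V) (w : G.Walk v v), w.IsCycle → 4 ≤ w.length →
        ∃ x y : V, x ∈ w.support ∧ y ∈ w.support ∧ G.Adj x y ∧ s(x, y) ∉ w.edges := by
  constructor
  · intro hdec v w hw hlen
    by_contra! hno
    obtain ⟨n, zs, hsum, hzs⟩ := hdec (walkChain R w) (isChainOn_walkChain w)
      (bdry_walkChain_eq_zero w)
    have hne : walkChain R w ≠ 0 := by
      match w, hw with
      | .nil, hw => exact absurd rfl hw.ne_nil
      | .cons (v := b) h p, hw =>
        intro h0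
        have := walkChain_mul_self (R := R) hw.isTrail (x := v) (y := b) (by simp)
        simp [h0] at this
    obtain ⟨i⟩ : Nonempty (Fin n) := by
      by_contra hn
      rw [not_nonempty_iff] at hn
      exact hne (by rw [hsum, Finset.univ_eq_empty, Finset.sum_empty])
    obtain ⟨⟨-, W, hW, hiff, hface⟩, hsub⟩ := hzs i
    obtain ⟨a, b, c, hab, hac, hbc, rfl⟩ :=
      Finset.card_eq_three.1 (by omega : W.card = 3)
    have hedge : ∀ x y, x ≠ y → ({x, y} : Finset V) ⊆ {a, b, c} → s(x, y) ∈ w.edges := by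
      intro x y hxy hs
      have hcard : ((({x, y} : Finset V).card : ℕ) : ℤ) = 1 + 1 := by
        rw [Finset.card_pair hxy]
        rfl
      have hz := (hiff _).2 ⟨hs, hcard⟩
      have hv : ∀ t ∈ ({x, y} : Finset V), t ∈ w.support := fun t ht => by
        have h1 := vsupp_smul_walkChain_subset (1 : R) w
        rw [one_smul] at h1
        exact h1 (hsub ⟨_, hz, ht⟩)
      exact hno x y (hv x (by simp)) (hv y (by simp))
        (adj_of_pair_mem_faces_graphComplex hxy (hface _ hs hcard))
    have := length_le_three_of_triangle hw hab hac hbc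
      (hedge a b hab (by intro; simp; tauto)) (hedge a c hac (by intro; simp; tauto))
      (hedge b c hbc (by intro; simp; tauto))
    omega
  · intro hG z hz hb
    exact exists_fin_sum_of_mem_closure (mem_closure_of_isChordal hG z hz hb)
end
end

section
/- Let R be a commutative ring, k ≥ 0, and let Δ be a finite abstract simplicial complex. Then Δ is decomposition k-chordal over R if and only if the k-clique complex Cl_k Δ is resolution k-chordal over R. -/
/-!
Basic notions for homological chordality of simplicial complexes,
following Adiprasito–Nevo–Samper, "Higher chordality: From graphs to complexes".

A finite abstract simplicial complex is modelled as a downward-closed finite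
family of finite subsets of a vertex type `V`.  Chains of dimension `k` (with
coefficients in a commutative ring `R`) are functions `Finset V → R` supported
on faces of cardinality `k + 1`; the simplicial boundary operator includes the
augmentation (so `0`-cycles are *reduced* cycles), matching the paper's
convention that `C₋₁` is generated by the empty face.
-/

open Finset

attribute [local instance] Classical.propDecidable

noncomputable section

variable {V : Type*} [Fintype V] [LinearOrder V]

lemma exists_eq_erase_of_card {V : Type*} {W s : Finset V} {k : ℤ} (hW : (W.card : ℤ) = k + 2)
    (hsW : s ⊆ W) (hs : (s.card : ℤ) = k + 1) : ∃ v ∈ W, s = W.erase v := by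
  obtain ⟨v, hvW, hvs⟩ := Finset.exists_mem_notMem_of_card_lt_card
    (s := s) (t := W) (by omega)
  refine ⟨v, hvW, Finset.eq_of_subset_of_card_le ?_ ?_⟩
  · exact fun x hx => Finset.mem_erase.2 ⟨fun h => hvs (h ▸ hx), hsW hx⟩
  · rw [Finset.card_erase_of_mem hvW]
    omega

lemma card_erase_of_card {V : Type*} {W : Finset V} {k : ℤ} (hW : (W.card : ℤ) = k + 2) {v : V}
    (hv : v ∈ W) : ((W.erase v).card : ℤ) = k + 1 := by
  have := Finset.card_erase_add_one hv
  omega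

lemma eq_sum_single {V R : Type*} [Fintype V] [CommRing R] (c : Finset V → R) :
    c = ∑ s, Pi.single s (c s) := by
  funext t
  simp [Finset.sum_apply, Pi.single_apply]

lemma mem_clique {V : Type*} [Fintype V] {Δ : ASC V} {k : ℤ} {s : Finset V} :
    s ∈ (clique Δ k).faces ↔
      (∀ v ∈ s, {v} ∈ Δ.faces) ∧ ∀ t ⊆ s, (t.card : ℤ) ≤ k + 1 → t ∈ Δ.faces := by
  simp [clique]

lemma exists_mem_face_of_card {V : Type*} {k : ℤ} (hk : 0 ≤ k) {W : Finset V}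
    (hW : (W.card : ℤ) = k + 2) {v : V} (hv : v ∈ W) : ∃ s ⊆ W, (s.card : ℤ) = k + 1 ∧ v ∈ s := by
  obtain ⟨u, hu, huv⟩ := Finset.exists_mem_ne (s := W) (by omega) v
  exact ⟨W.erase u, Finset.erase_subset _ _, card_erase_of_card hW hu,
    Finset.mem_erase.2 ⟨huv.symm, hv⟩⟩

lemma mem_clique_of_mem {V : Type*} [Fintype V] {Δ : ASC V} {k : ℤ} {s : Finset V}
    (hs : s ∈ Δ.faces) : s ∈ (clique Δ k).faces :=
  mem_clique.2 ⟨fun _ hv => Δ.down_closed hs (Finset.singleton_subset_iff.2 hv),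
    fun _ ht _ => Δ.down_closed hs ht⟩

lemma mem_clique_of_facets {V : Type*} [Fintype V] {Δ : ASC V} {k : ℤ} (hk : 0 ≤ k)
    {W : Finset V} (hW : (W.card : ℤ) = k + 2)
    (h : ∀ s : Finset V, s ⊆ W → (s.card : ℤ) = k + 1 → s ∈ Δ.faces) :
    W ∈ (clique Δ k).faces := by
  have key : ∀ t ⊆ W, (t.card : ℤ) ≤ k + 1 → t ∈ Δ.faces := by
    intro t ht hc
    obtain ⟨u, htu, huW, hu⟩ := Finset.exists_subsuperset_card_eq (n := (k + 1).toNat) ht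
      (by omega) (by omega)
    exact Δ.down_closed (h u huW (by omega)) htu
  refine mem_clique.2 ⟨fun v hv => key _ (Finset.singleton_subset_iff.2 hv) ?_, key⟩
  rw [Finset.card_singleton]
  omega

lemma isChainOn_clique_iff {V R : Type*} [Fintype V] [CommRing R] {Δ : ASC V} {k : ℤ}
    {z : Finset V → R} :
    IsChainOn (↑(clique Δ k).faces) k z ↔ IsChainOn (↑Δ.faces) k z := by
  refine forall₂_congr fun s _ => and_congr_left fun hs => ⟨fun h => ?_, mem_clique_of_mem⟩
  exact (mem_clique.1 (Finset.mem_coe.1 h)).2 s subset_rfl hs.le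

section SimplexChains

variable {V : Type*} [LinearOrder V] {R : Type*} [CommRing R]

lemma esign_mul_self (v : V) (t : Finset V) : esign v t * esign v t = 1 := by
  rw [esign, ← mul_pow]
  simp

lemma esign_smul_esign_smul (v : V) (t : Finset V) (a : R) :
    esign v t • esign v t • a = a := by
  rw [smul_smul, esign_mul_self, one_smul]

lemma esign_smul_eq_zero_iff (v : V) (t : Finset V) (a : R) : esign v t • a = 0 ↔ a = 0 := by
  refine ⟨fun h => ?_, fun h => by rw [h, smul_zero]⟩
  rw [← esign_smul_esign_smul v t a, h, smul_zero]

lemma esign_insert {v w : V} {t : Finset V} (hv : v ∉ t) :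
    esign w (insert v t) = (if v < w then -1 else 1) * esign w t := by
  unfold esign
  rw [Finset.filter_insert]
  split_ifs
  · rw [Finset.card_insert_of_notMem (by simp [hv]), pow_succ, mul_comm]
  · rw [one_mul]

lemma esign_mul_esign_insert {v w : V} {t : Finset V} (hv : v ∉ t) (hw : w ∉ t) (hvw : v ≠ w) :
    esign v t * esign w (insert v t) = -(esign w t * esign v (insert w t)) := by
  rw [esign_insert hv, esign_insert hw]
  rcases lt_or_gt_of_ne hvw with h | h
  · rw [if_pos h, if_neg h.not_gt]
    ring
  · rw [if_neg h.not_gt, if_pos h]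
    ring

variable [Fintype V]

lemma bdry_sum {ι : Type*} (s : Finset ι) (c : ι → Finset V → R) :
    bdry (∑ i ∈ s, c i) = ∑ i ∈ s, bdry (c i) := by
  funext t
  simp only [bdry, Finset.sum_apply, Finset.smul_sum]
  exact Finset.sum_comm

lemma bdry_sub (c d : Finset V → R) : bdry (c - d) = bdry c - bdry d := by
  funext t
  simp [bdry, smul_sub, Finset.sum_sub_distrib]

lemma bdry_bdry (c : Finset V → R) : bdry (bdry c) = 0 := by
  funext t
  simp only [bdry, Finset.smul_sum, Pi.zero_apply]
  rw [Finset.sum_sigma']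
  refine Finset.sum_involution (fun p _ => ⟨p.2, p.1⟩) ?_ ?_ ?_ ?_
  · rintro ⟨v, w⟩ h
    simp only [Finset.mem_sigma, Finset.mem_compl, Finset.mem_insert, not_or] at h
    dsimp only
    rw [smul_smul, smul_smul, esign_mul_esign_insert h.1 h.2.2 (Ne.symm h.2.1),
      Finset.insert_comm, neg_smul, neg_add_cancel]
  · rintro ⟨v, w⟩ h _ heq
    simp only [Finset.mem_sigma, Finset.mem_compl, Finset.mem_insert, not_or] at h
    exact h.2.1 (Sigma.mk.inj_iff.1 heq).1
  · rintro ⟨v, w⟩ h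
    simp only [Finset.mem_sigma, Finset.mem_compl, Finset.mem_insert, not_or] at h ⊢
    exact ⟨h.2.2, Ne.symm h.2.1, h.1⟩
  · rintro ⟨v, w⟩ _
    rfl

lemma bdry_single_erase {W : Finset V} {v : V} (hv : v ∈ W) (a : R) :
    bdry (Pi.single W a) (W.erase v) = esign v (W.erase v) • a := by
  unfold bdry
  rw [Finset.sum_eq_single v]
  · rw [Finset.insert_erase hv, Pi.single_eq_same]
  · intro u hu huv
    rw [Pi.single_eq_of_ne, smul_zero]
    intro h
    have hmem : v ∈ insert u (W.erase v) := by rwa [h]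
    simp [Ne.symm huv] at hmem
  · intro h
    simp at h

lemma exists_eq_erase_of_bdry_single_ne_zero {W s : Finset V} {a : R}
    (h : bdry (Pi.single W a) s ≠ 0) : ∃ v ∈ W, s = W.erase v := by
  obtain ⟨v, hv, hne⟩ := Finset.exists_ne_zero_of_sum_ne_zero h
  have hW : insert v s = W := by
    by_contra hW
    exact hne (by rw [Pi.single_eq_of_ne hW, smul_zero])
  refine ⟨v, hW ▸ Finset.mem_insert_self v s, ?_⟩
  rw [← hW, Finset.erase_insert (Finset.mem_compl.1 hv)]

lemma isCompleteCycleOn_bdry_single {S : Set (Finset V)} {k : ℤ} {W : Finset V} {a : R}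
    (ha : a ≠ 0) (hW : (W.card : ℤ) = k + 2)
    (hS : ∀ s : Finset V, s ⊆ W → (s.card : ℤ) = k + 1 → s ∈ S) :
    IsCompleteCycleOn S k (bdry (Pi.single W a)) := by
  refine ⟨bdry_bdry _, W, hW, fun s => ⟨fun h => ?_, fun h => ?_⟩, hS⟩
  · obtain ⟨v, hv, rfl⟩ := exists_eq_erase_of_bdry_single_ne_zero h
    exact ⟨Finset.erase_subset _ _, card_erase_of_card hW hv⟩
  · obtain ⟨v, hv, rfl⟩ := exists_eq_erase_of_card hW h.1 h.2
    rw [bdry_single_erase hv]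
    exact (esign_smul_eq_zero_iff _ _ _).not.2 ha

/-- A cycle of the boundary of a simplex that vanishes on some facet is zero. -/
lemma eq_zero_of_bdry_eq_zero {W : Finset V} {d : Finset V → R} (hd : bdry d = 0)
    (hsupp : ∀ s, d s ≠ 0 → ∃ v ∈ W, s = W.erase v) {v : V} (hv : v ∈ W)
    (hdv : d (W.erase v) = 0) : d = 0 := by
  funext s
  by_contra hs
  obtain ⟨u, hu, rfl⟩ := hsupp s hs
  have huv : v ≠ u := by
    rintro rfl
    exact hs hdv
  have hvu : v ∈ W.erase u := Finset.mem_erase.2 ⟨huv, hv⟩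
  have h := congrFun hd ((W.erase u).erase v)
  unfold bdry at h
  rw [Finset.sum_eq_single v] at h
  · rw [Finset.insert_erase hvu] at h
    exact hs ((esign_smul_eq_zero_iff _ _ _).1 h)
  · intro x hx hxv
    suffices d (insert x ((W.erase u).erase v)) = 0 by rw [this, smul_zero]
    by_contra hne
    obtain ⟨y, _, hy⟩ := hsupp _ hne
    have hxW : x ∈ W := Finset.mem_of_mem_erase (hy ▸ Finset.mem_insert_self x _)
    have hxu : x = u := by
      by_contra hxu
      exact Finset.mem_compl.1 hx
        (Finset.mem_erase.2 ⟨hxv, Finset.mem_erase.2 ⟨hxu, hxW⟩⟩)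
    subst hxu
    rw [Finset.erase_right_comm,
      Finset.insert_erase (Finset.mem_erase.2 ⟨huv.symm, hu⟩)] at hne
    exact hne hdv
  · intro h
    simp at h

lemma eq_bdry_single_of_cycle {W : Finset V} {z : Finset V → R} (hz : bdry z = 0)
    (hsupp : ∀ s, z s ≠ 0 → ∃ v ∈ W, s = W.erase v) (hW : W.Nonempty) :
    ∃ a : R, z = bdry (Pi.single W a) := by
  obtain ⟨v, hv⟩ := hW
  refine ⟨esign v (W.erase v) • z (W.erase v), sub_eq_zero.1 (eq_zero_of_bdry_eq_zero (W := W)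
    (by rw [bdry_sub, hz, bdry_bdry, sub_zero]) (fun s hs => ?_) hv ?_)⟩
  · by_cases h : z s = 0
    · refine exists_eq_erase_of_bdry_single_ne_zero
        (a := esign v (W.erase v) • z (W.erase v)) fun h0 => hs ?_
      rw [Pi.sub_apply, h, h0, sub_zero]
    · exact hsupp s h
  · rw [Pi.sub_apply, bdry_single_erase hv, esign_smul_esign_smul, sub_self]

lemma vsupp_bdry_subset (c : Finset V → R) : vsupp (bdry c) ⊆ vsupp c := by
  rintro v ⟨s, hs, hv⟩
  obtain ⟨w, _, hne⟩ := Finset.exists_ne_zero_of_sum_ne_zero hs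
  exact ⟨insert w s, fun h => hne (by rw [h, smul_zero]), Finset.mem_insert_of_mem hv⟩

end SimplexChains

section Clique

variable {V : Type*} [Fintype V] [LinearOrder V] {Δ : ASC V} {k : ℤ}

/-- A complete cycle is the boundary of a multiple of a `(k+1)`-simplex of the clique complex
on the same vertices. -/
lemma IsCompleteCycleOn.exists_eq_bdry_single {R : Type*} [CommRing R] (hk : 0 ≤ k)
    {z : Finset V → R} (hz : IsCompleteCycleOn (↑Δ.faces) k z) :
    ∃ (W : Finset V) (a : R), W ∈ (clique Δ k).faces ∧ (W.card : ℤ) = k + 1 + 1 ∧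
      ↑W ⊆ vsupp z ∧ z = bdry (Pi.single W a) := by
  obtain ⟨hcyc, W, hW, hsupp, hfaces⟩ := hz
  obtain ⟨a, ha⟩ := eq_bdry_single_of_cycle hcyc
    (fun s hs => exists_eq_erase_of_card hW ((hsupp s).1 hs).1 ((hsupp s).1 hs).2)
    (Finset.card_pos.1 (by omega))
  refine ⟨W, a, mem_clique_of_facets hk hW hfaces, by omega, fun v hv => ?_, ha⟩
  obtain ⟨s, hsW, hs, hvs⟩ := exists_mem_face_of_card hk hW hv
  exact ⟨s, (hsupp s).2 ⟨hsW, hs⟩, hvs⟩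

lemma DecChordal.resChordal_clique {R : Type*} [CommRing R] (hk : 0 ≤ k)
    (h : DecChordal R Δ k) : ResChordal R (clique Δ k) k := by
  intro z hz hcyc
  obtain ⟨n, zs, hsum, hzs⟩ := h z (isChainOn_clique_iff.1 hz) hcyc
  choose W a hWmem hWcard hWsupp hza using fun i => (hzs i).1.exists_eq_bdry_single hk
  have hne : ∀ s : Finset V, (∑ i, Pi.single (W i) (a i) : Finset V → R) s ≠ 0 →
      ∃ i, s = W i := by
    intro s hs
    rw [Finset.sum_apply] at hs
    obtain ⟨i, _, hi⟩ := Finset.exists_ne_zero_of_sum_ne_zero hs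
    exact ⟨i, by_contra fun h => hi (Pi.single_eq_of_ne h _)⟩
  have hbdry : bdry (∑ i, Pi.single (W i) (a i) : Finset V → R) = z := by
    rw [bdry_sum, hsum]
    exact Finset.sum_congr rfl fun i _ => (hza i).symm
  refine ⟨∑ i, Pi.single (W i) (a i), fun s hs => ?_, hbdry, subset_antisymm ?_ ?_⟩
  · obtain ⟨i, rfl⟩ := hne s hs
    exact ⟨hWmem i, hWcard i⟩
  · rintro v ⟨s, hs, hv⟩
    obtain ⟨i, rfl⟩ := hne s hs
    exact (hzs i).2 (hWsupp i hv)
  · conv_lhs => rw [← hbdry]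
    exact vsupp_bdry_subset _

lemma DecChordal.of_resChordal_clique {R : Type*} [CommRing R]
    (h : ResChordal R (clique Δ k) k) : DecChordal R Δ k := by
  intro z hz hcyc
  obtain ⟨c, hc, rfl, hsupp⟩ := h z (isChainOn_clique_iff.2 hz) hcyc
  let T : Finset (Finset V) := Finset.univ.filter fun s => c s ≠ 0
  have hT : ∀ i, c (T.equivFin.symm i).1 ≠ 0 := fun i =>
    (Finset.mem_filter.1 (T.equivFin.symm i).2).2
  refine ⟨T.card, fun i => bdry (Pi.single (T.equivFin.symm i).1 (c (T.equivFin.symm i).1)),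
    ?_, fun i => ⟨?_, ?_⟩⟩
  · rw [T.equivFin.symm.sum_comp fun s : T => bdry (Pi.single s.1 (c s.1)),
      Finset.sum_coe_sort T fun s => bdry (Pi.single s (c s)), ← bdry_sum]
    conv_lhs => rw [eq_sum_single c]
    congr 1
    refine (Finset.sum_filter_of_ne (p := fun s => c s ≠ 0) fun s _ hs hcs => hs ?_).symm
    rw [hcs, Pi.single_zero]
  · obtain ⟨hmem, hcard⟩ := hc _ (hT i)
    exact isCompleteCycleOn_bdry_single (hT i) (by omega) fun s hs hs' =>
      (mem_clique.1 (Finset.mem_coe.1 hmem)).2 s hs hs'.le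
  · rw [← hsupp]
    rintro v ⟨s, hs, hv⟩
    obtain ⟨u, _, rfl⟩ := exists_eq_erase_of_bdry_single_ne_zero hs
    exact ⟨_, hT i, Finset.mem_of_mem_erase hv⟩

end Clique

/-- Fact 3.1(2): `Δ` is decomposition `k`-chordal over `R` if and only if its
`k`-clique complex `Cl_k Δ` is resolution `k`-chordal over `R`. -/
theorem decChordal_iff_clique_resChordal {V : Type*} [Fintype V] [LinearOrder V]
    (R : Type*) [CommRing R] (k : ℤ) (hk : 0 ≤ k) (Δ : ASC V) :
    DecChordal R Δ k ↔ ResChordal R (clique Δ k) k :=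
  ⟨fun h => h.resChordal_clique hk, DecChordal.of_resChordal_clique⟩
end
end
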